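/- Gauge invariance of the flat depth-2 spin-2 operator in dimension 4: let λ be a smooth real-valued function on ℝ⁴ (independent of p). Then the operator G₂ := ∂² − (2/3)(p·∂)(∂_p·∂) + (1/6) p² (∂_p·∂)² annihilates the depth-2 gauge variation: G₂( ((p·∂)² − (1/4) p² ∂²) λ ) = 0, where ((p·∂)² − (1/4) p² ∂²)λ is regarded as a function of (x,p), quadratic in p. -/

import Mathlib

noncomputable section

/-- Partial derivative in the `x` variable, direction `a`, of a function `f(x,p)`. -/
def pdX {m : ℕ} (a : Fin m) (f : (Fin m → ℝ) → (Fin m → ℝ) → ℝ) :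
    (Fin m → ℝ) → (Fin m → ℝ) → ℝ :=
  fun x p => fderiv ℝ (fun y => f y p) x (Pi.single a 1)

/-- Partial derivative in the `p` variable, direction `a`, of a function `f(x,p)`. -/
def pdP {m : ℕ} (a : Fin m) (f : (Fin m → ℝ) → (Fin m → ℝ) → ℝ) :
    (Fin m → ℝ) → (Fin m → ℝ) → ℝ :=
  fun x p => fderiv ℝ (f x) p (Pi.single a 1)

/-- The wave operator `∂² = η^{ab} ∂_{x^a} ∂_{x^b}` for the diagonal metric `ε`. -/
def lapX {m : ℕ} (ε : Fin m → ℝ) (f : (Fin m → ℝ) → (Fin m → ℝ) → ℝ) :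
    (Fin m → ℝ) → (Fin m → ℝ) → ℝ :=
  fun x p => ∑ a, ε a * pdX a (pdX a f) x p

/-- The operator `p·∂ = p^a ∂_{x^a}`. -/
def pdot {m : ℕ} (f : (Fin m → ℝ) → (Fin m → ℝ) → ℝ) :
    (Fin m → ℝ) → (Fin m → ℝ) → ℝ :=
  fun x p => ∑ a, p a * pdX a f x p

/-- The divergence operator `∂_p·∂ = η^{ab} ∂_{p^a} ∂_{x^b}`. -/
def dpd {m : ℕ} (ε : Fin m → ℝ) (f : (Fin m → ℝ) → (Fin m → ℝ) → ℝ) :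
    (Fin m → ℝ) → (Fin m → ℝ) → ℝ :=
  fun x p => ∑ a, ε a * pdP a (pdX a f) x p

/-- `p² = η_{ab} p^a p^b`. -/
def psq {m : ℕ} (ε : Fin m → ℝ) (p : Fin m → ℝ) : ℝ :=
  ∑ a, ε a * p a ^ 2

/-- Iterated `p`-derivative along a list of indices. -/
def pdPList {m : ℕ} : List (Fin m) → ((Fin m → ℝ) → (Fin m → ℝ) → ℝ) →
    (Fin m → ℝ) → (Fin m → ℝ) → ℝ
  | [], f => f
  | a :: as, f => pdP a (pdPList as f)

/-- Partial derivative of a one-variable function on `ℝ^m`. -/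
def pd {m : ℕ} (a : Fin m) (f : (Fin m → ℝ) → ℝ) : (Fin m → ℝ) → ℝ :=
  fun x => fderiv ℝ f x (Pi.single a 1)

/-- The wave operator on one-variable functions on `ℝ^m`. -/
def lap {m : ℕ} (ε : Fin m → ℝ) (f : (Fin m → ℝ) → ℝ) : (Fin m → ℝ) → ℝ :=
  fun x => ∑ a, ε a * pd a (pd a f) x

section GaugeVariation

variable {m : ℕ}

lemma contDiff_pd (a : Fin m) {f : (Fin m → ℝ) → ℝ} (hf : ContDiff ℝ (⊤ : ℕ∞) f) :
    ContDiff ℝ (⊤ : ℕ∞) (pd a f) :=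
  (hf.fderiv_right (m := (⊤ : ℕ∞)) (by simp)).clm_apply contDiff_const

lemma differentiable_of_smooth {f : (Fin m → ℝ) → ℝ} (hf : ContDiff ℝ (⊤ : ℕ∞) f) :
    Differentiable ℝ f :=
  hf.differentiable (by simp)

lemma contDiff_lap (ε : Fin m → ℝ) {f : (Fin m → ℝ) → ℝ} (hf : ContDiff ℝ (⊤ : ℕ∞) f) :
    ContDiff ℝ (⊤ : ℕ∞) (lap ε f) :=
  ContDiff.sum fun a _ => contDiff_const.mul (contDiff_pd a (contDiff_pd a hf))

lemma pd_comm (a b : Fin m) {f : (Fin m → ℝ) → ℝ} (hf : ContDiff ℝ (⊤ : ℕ∞) f) :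
    pd a (pd b f) = pd b (pd a f) := by
  have hd : Differentiable ℝ (fderiv ℝ f) :=
    (hf.fderiv_right (m := (⊤ : ℕ∞)) (by simp)).differentiable (by simp)
  have key (u v : Fin m) (x : Fin m → ℝ) :
      pd u (pd v f) x = fderiv ℝ (fderiv ℝ f) x (Pi.single u 1) (Pi.single v 1) := by
    unfold pd
    rw [fderiv_clm_apply (hd x) (differentiableAt_const _)]
    simp
  funext x
  rw [key, key]
  exact (hf.contDiffAt.isSymmSndFDerivAt (by simpa using WithTop.coe_le_coe.2 (le_top : (2 : ℕ∞) ≤ ⊤))) _ _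

lemma pd_const_mul (a : Fin m) (c : ℝ) (f : (Fin m → ℝ) → ℝ) (x : Fin m → ℝ) :
    pd a (fun z => c * f z) x = c * pd a f x := by
  unfold pd
  rw [show (fun z => c * f z) = c • f from rfl, fderiv_const_smul_field]
  simp

lemma lap_const_mul (ε : Fin m → ℝ) (c : ℝ) (f : (Fin m → ℝ) → ℝ) (x : Fin m → ℝ) :
    lap ε (fun z => c * f z) x = c * lap ε f x := by
  simp only [lap, show ∀ a, pd a (fun z => c * f z) = fun z => c * pd a f z from
    fun a => funext (pd_const_mul a c f), pd_const_mul, Finset.mul_sum]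
  exact Finset.sum_congr rfl fun _ _ => by ring

lemma pd_sum_mul (a : Fin m) (c : Fin m → ℝ) {g : Fin m → (Fin m → ℝ) → ℝ}
    (hg : ∀ b, ContDiff ℝ (⊤ : ℕ∞) (g b)) (x : Fin m → ℝ) :
    pd a (fun z => ∑ b, c b * g b z) x = ∑ b, c b * pd a (g b) x := by
  unfold pd
  rw [fderiv_fun_sum fun b _ => (differentiable_of_smooth (hg b) x).const_mul (c b)]
  simp only [sum_apply]
  exact Finset.sum_congr rfl fun b _ => pd_const_mul a (c b) (g b) x

lemma pd_sub (a : Fin m) {f g : (Fin m → ℝ) → ℝ} (hf : ContDiff ℝ (⊤ : ℕ∞) f)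
    (hg : ContDiff ℝ (⊤ : ℕ∞) g) (x : Fin m → ℝ) :
    pd a (fun z => f z - g z) x = pd a f x - pd a g x := by
  unfold pd
  rw [fderiv_fun_sub (differentiable_of_smooth hf x) (differentiable_of_smooth hg x)]
  simp

lemma pd_lap (ε : Fin m → ℝ) (a : Fin m) {f : (Fin m → ℝ) → ℝ}
    (hf : ContDiff ℝ (⊤ : ℕ∞) f) : pd a (lap ε f) = lap ε (pd a f) := by
  funext x
  unfold lap
  rw [pd_sum_mul a ε fun b => contDiff_pd b (contDiff_pd b hf)]
  refine Finset.sum_congr rfl fun b _ => ?_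
  rw [pd_comm a b (contDiff_pd b hf), pd_comm a b hf]

/-- The gradient term `(p·∂) g` of a `p`-independent function `g`. -/
def grad (g : (Fin m → ℝ) → ℝ) : (Fin m → ℝ) → (Fin m → ℝ) → ℝ :=
  fun x p => ∑ b, p b * pd b g x

/-- The depth-2 gauge variation `((p·∂)² - (1/4) p² ∂²) f`. -/
def gaugeVar (ε : Fin m → ℝ) (f : (Fin m → ℝ) → ℝ) : (Fin m → ℝ) → (Fin m → ℝ) → ℝ :=
  fun y q => (∑ a, q a * pd a (fun z => ∑ b, q b * pd b f z) y)
    - (1 / 4) * psq ε q * lap ε f y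

lemma grad_const_mul (c : ℝ) (g : (Fin m → ℝ) → ℝ) (x p : Fin m → ℝ) :
    grad (fun z => c * g z) x p = c * grad g x p := by
  simp only [grad, pd_const_mul, Finset.mul_sum]
  exact Finset.sum_congr rfl fun _ _ => by ring

lemma contDiff_grad {g : (Fin m → ℝ) → ℝ} (hg : ContDiff ℝ (⊤ : ℕ∞) g) (q : Fin m → ℝ) :
    ContDiff ℝ (⊤ : ℕ∞) (fun z => grad g z q) :=
  ContDiff.sum fun b _ => contDiff_const.mul (contDiff_pd b hg)

lemma pdX_grad (a : Fin m) {g : (Fin m → ℝ) → ℝ} (hg : ContDiff ℝ (⊤ : ℕ∞) g) :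
    pdX a (grad g) = grad (pd a g) := by
  funext x q
  change pd a (fun z => ∑ b, q b * pd b g z) x = _
  rw [pd_sum_mul a q fun b => contDiff_pd b hg]
  exact Finset.sum_congr rfl fun b _ => by rw [pd_comm a b hg]

lemma hasFDerivAt_grad (g : (Fin m → ℝ) → ℝ) (x p : Fin m → ℝ) :
    HasFDerivAt (grad g x)
      (∑ b, pd b g x • (ContinuousLinearMap.proj b : (Fin m → ℝ) →L[ℝ] ℝ)) p := by
  unfold grad
  exact HasFDerivAt.fun_sum fun b _ => (hasFDerivAt_apply b p).mul_const _

lemma pdP_grad (a : Fin m) (g : (Fin m → ℝ) → ℝ) (x p : Fin m → ℝ) :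
    pdP a (grad g) x p = pd a g x := by
  unfold pdP
  rw [(hasFDerivAt_grad g x p).fderiv]
  simp [Pi.single_apply]

lemma dpd_grad (ε : Fin m → ℝ) {g : (Fin m → ℝ) → ℝ} (hg : ContDiff ℝ (⊤ : ℕ∞) g)
    (x p : Fin m → ℝ) : dpd ε (grad g) x p = lap ε g x := by
  unfold dpd lap
  simp only [pdX_grad _ hg, pdP_grad]

lemma gaugeVar_apply (ε : Fin m → ℝ) {f : (Fin m → ℝ) → ℝ} (hf : ContDiff ℝ (⊤ : ℕ∞) f)
    (y q : Fin m → ℝ) :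
    gaugeVar ε f y q = (∑ a, q a * grad (pd a f) y q) - (1 / 4) * psq ε q * lap ε f y := by
  unfold gaugeVar
  congr 1
  exact Finset.sum_congr rfl fun a _ => congrArg (q a * ·) (congrFun₂ (pdX_grad a hf) y q)

lemma pdX_gaugeVar (ε : Fin m → ℝ) (c : Fin m) {f : (Fin m → ℝ) → ℝ}
    (hf : ContDiff ℝ (⊤ : ℕ∞) f) : pdX c (gaugeVar ε f) = gaugeVar ε (pd c f) := by
  funext y q
  change pd c (fun z => gaugeVar ε f z q) y = _
  simp only [gaugeVar_apply ε hf, gaugeVar_apply ε (contDiff_pd c hf)]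
  rw [pd_sub c
    (ContDiff.sum fun a _ => contDiff_const.mul (contDiff_grad (contDiff_pd a hf) q))
    (contDiff_const.mul (contDiff_lap ε hf)),
    pd_sum_mul c q fun a => contDiff_grad (contDiff_pd a hf) q, pd_const_mul, pd_lap ε c hf]
  congr 1
  refine Finset.sum_congr rfl fun a _ => ?_
  rw [pd_comm a c hf]
  exact congrArg (q a * ·) (congrFun₂ (pdX_grad c (contDiff_pd a hf)) y q)

lemma pdP_gaugeVar (ε : Fin m → ℝ) (a : Fin m) {f : (Fin m → ℝ) → ℝ}
    (hf : ContDiff ℝ (⊤ : ℕ∞) f) (x p : Fin m → ℝ) :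
    pdP a (gaugeVar ε f) x p =
      2 * grad (pd a f) x p - (1 / 2) * (ε a * p a) * lap ε f x := by
  have hpsq : HasFDerivAt (psq ε)
      (∑ b, ε b • (2 * p b) • (ContinuousLinearMap.proj b : (Fin m → ℝ) →L[ℝ] ℝ)) p := by
    unfold psq
    refine HasFDerivAt.fun_sum fun b _ => HasFDerivAt.const_mul ?_ _
    simpa using (hasFDerivAt_apply (𝕜 := ℝ) b p).pow 2
  have h := (HasFDerivAt.fun_sum fun c (_ : c ∈ Finset.univ) =>
    (hasFDerivAt_apply (𝕜 := ℝ) c p).mul (hasFDerivAt_grad (pd c f) x p)).fun_sub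
      ((hpsq.const_mul (1 / 4)).mul_const (lap ε f x))
  unfold pdP
  rw [(h.congr_of_eventuallyEq (.of_forall (gaugeVar_apply ε hf x))).fderiv]
  simp [Pi.single_apply, Finset.sum_add_distrib]
  have hsum : ∑ c, p c * pd a (pd c f) x = grad (pd a f) x p :=
    Finset.sum_congr rfl fun c _ => by rw [pd_comm a c hf]
  rw [hsum]
  ring

lemma pd_lap_eq_sum (ε : Fin m → ℝ) (b : Fin m) {f : (Fin m → ℝ) → ℝ}
    (hf : ContDiff ℝ (⊤ : ℕ∞) f) (x : Fin m → ℝ) :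
    pd b (lap ε f) x = ∑ a, ε a * pd b (pd a (pd a f)) x :=
  pd_sum_mul b ε (fun a => contDiff_pd a (contDiff_pd a hf)) x

lemma sum_grad_pd_pd (ε : Fin m → ℝ) {f : (Fin m → ℝ) → ℝ} (hf : ContDiff ℝ (⊤ : ℕ∞) f)
    (x p : Fin m → ℝ) : ∑ a, ε a * grad (pd a (pd a f)) x p = grad (lap ε f) x p := by
  simp only [grad, pd_lap_eq_sum ε _ hf, Finset.mul_sum]
  rw [Finset.sum_comm]
  exact Finset.sum_congr rfl fun _ _ => Finset.sum_congr rfl fun _ _ => by ring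

lemma lapX_gaugeVar (ε : Fin m → ℝ) {f : (Fin m → ℝ) → ℝ} (hf : ContDiff ℝ (⊤ : ℕ∞) f)
    (x p : Fin m → ℝ) :
    lapX ε (gaugeVar ε f) x p = gaugeVar ε (lap ε f) x p := by
  have hpd2 (c a : Fin m) : pd c (pd a (pd a f)) = pd a (pd a (pd c f)) := by
    rw [pd_comm c a (contDiff_pd a hf), pd_comm c a hf]
  have hgrad (c : Fin m) :
      grad (pd c (lap ε f)) x p = ∑ a, ε a * grad (pd c (pd a (pd a f))) x p := by
    rw [pd_lap ε c hf, ← sum_grad_pd_pd ε (contDiff_pd c hf)]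
    exact Finset.sum_congr rfl fun a _ => by rw [hpd2]
  have hlap : lap ε (lap ε f) x = ∑ a, ε a * lap ε (pd a (pd a f)) x :=
    Finset.sum_congr rfl fun a _ => by
      rw [pd_lap ε a hf, pd_lap ε a (contDiff_pd a hf)]
  unfold lapX
  simp only [pdX_gaugeVar ε _ hf, pdX_gaugeVar ε _ (contDiff_pd _ hf),
    gaugeVar_apply ε (contDiff_pd _ (contDiff_pd _ hf)), gaugeVar_apply ε (contDiff_lap ε hf),
    hgrad, hlap, mul_sub, Finset.sum_sub_distrib, Finset.mul_sum]
  congr 1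
  · rw [Finset.sum_comm]
    exact Finset.sum_congr rfl fun _ _ => Finset.sum_congr rfl fun _ _ => by ring
  · exact Finset.sum_congr rfl fun _ _ => by ring

lemma dpd_gaugeVar {ε : Fin m → ℝ} (hε : ∀ a, ε a = 1 ∨ ε a = -1) {f : (Fin m → ℝ) → ℝ}
    (hf : ContDiff ℝ (⊤ : ℕ∞) f) :
    dpd ε (gaugeVar ε f) = grad (fun z => (3 / 2) * lap ε f z) := by
  funext x p
  have hsq (a : Fin m) : ε a * ε a = 1 := by rcases hε a with h | h <;> simp [h]
  calc dpd ε (gaugeVar ε f) x p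
      = ∑ a, (2 * (ε a * grad (pd a (pd a f)) x p) - (1 / 2) * (p a * pd a (lap ε f) x)) := by
        unfold dpd
        refine Finset.sum_congr rfl fun a _ => ?_
        rw [pdX_gaugeVar ε a hf, pdP_gaugeVar ε a (contDiff_pd a hf), pd_lap ε a hf]
        linear_combination (-(1 / 2) * p a * lap ε (pd a f) x) * hsq a
    _ = 2 * grad (lap ε f) x p - (1 / 2) * grad (lap ε f) x p := by
        rw [Finset.sum_sub_distrib, ← Finset.mul_sum, ← Finset.mul_sum, sum_grad_pd_pd ε hf, grad]
    _ = _ := by rw [grad_const_mul]; ring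

end GaugeVariation

/-- gauge invariance of the flat depth-2 spin-2 operator in dimension 4: for a
smooth `λ` on `ℝ⁴`, the operator `G₂ = ∂² - (2/3)(p·∂)(∂_p·∂) + (1/6) p² (∂_p·∂)²`
annihilates the depth-2 gauge variation `((p·∂)² - (1/4) p² ∂²) λ`. -/
theorem depth_two_spin_two_gauge_invariance
    (ε : Fin 4 → ℝ) (hε : ∀ a, ε a = 1 ∨ ε a = -1)
    (lam : (Fin 4 → ℝ) → ℝ) (hlam : ContDiff ℝ (⊤ : ℕ∞) lam) :
    ∀ (x p : Fin 4 → ℝ),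
      lapX ε (fun y q => (∑ a, q a * pd a (fun z => ∑ b, q b * pd b lam z) y)
          - (1 / 4) * psq ε q * lap ε lam y) x p
        - (2 / 3) * pdot (dpd ε (fun y q =>
            (∑ a, q a * pd a (fun z => ∑ b, q b * pd b lam z) y)
              - (1 / 4) * psq ε q * lap ε lam y)) x p
        + (1 / 6) * psq ε p * dpd ε (dpd ε (fun y q =>
            (∑ a, q a * pd a (fun z => ∑ b, q b * pd b lam z) y)
              - (1 / 4) * psq ε q * lap ε lam y)) x p
      = 0 := by
  intro x p
  have hL := contDiff_lap ε hlam
  have hL' : ContDiff ℝ (⊤ : ℕ∞) (fun z => (3 / 2) * lap ε lam z) := contDiff_const.mul hL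
  change lapX ε (gaugeVar ε lam) x p - (2 / 3) * pdot (dpd ε (gaugeVar ε lam)) x p
    + (1 / 6) * psq ε p * dpd ε (dpd ε (gaugeVar ε lam)) x p = 0
  have hpdot : pdot (grad fun z => (3 / 2) * lap ε lam z) x p =
      (3 / 2) * ∑ a, p a * grad (pd a (lap ε lam)) x p := by
    simp only [pdot, pdX_grad _ hL', Finset.mul_sum]
    refine Finset.sum_congr rfl fun a _ => ?_
    rw [show pd a (fun z => (3 / 2) * lap ε lam z) = fun z => (3 / 2) * pd a (lap ε lam) z from
      funext (pd_const_mul a _ _), grad_const_mul]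
    ring
  have hlap : lap ε (fun z => (3 / 2) * lap ε lam z) x = (3 / 2) * lap ε (lap ε lam) x := by
    simp only [lap_const_mul]
  rw [dpd_gaugeVar hε hlam, dpd_grad ε hL', lapX_gaugeVar ε hlam, gaugeVar_apply ε hL, hpdot,
    hlap]
  ring

end
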